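/- For every integer k ≥ 1, every vector β of nonzero complex numbers with β := β_1⋯β_k, and every z ∈ ℂ∖{0, β}: φ^g(z;β)·φ^b(z;−β,1) = I = φ^b(z;−β,1)·φ^g(z;β), where −β = (−β_1,…,−β_k) and 1 = (1,…,1); in particular φ^g(z;β) is invertible with inverse φ^b(z;−β,1). -/

import Mathlib

open scoped BigOperators

/-- The matrix `φ^b(z;α,γ)`: `diag(γ) + Σ_{i=1}^{k−1} α_i E_{i+1,i} + α_k z⁻¹ E_{1,k}`
(indices here are 0-based). -/
noncomputable def phiB (k : ℕ) (z : ℂ) (α γ : Fin k → ℂ) : Matrix (Fin k) (Fin k) ℂ :=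
  Matrix.of fun (i j : Fin k) =>
    (if i = j then γ i else 0) + (if (i : ℕ) = (j : ℕ) + 1 then α j else 0) +
      (if (i : ℕ) = 0 ∧ (j : ℕ) = k - 1 then α j * z⁻¹ else 0)

/-- Value of a `Fin k`-indexed vector at a natural number (1 outside range). -/
noncomputable def bval {k : ℕ} (β : Fin k → ℂ) (m : ℕ) : ℂ :=
  if h : m < k then β ⟨m, h⟩ else 1

/-- The matrix `φ^g(z;β) = (1 − β z⁻¹)⁻¹ G(z;β)` with
`G_{ij} = β_j⋯β_{i−1}` for `i ≥ j` and `G_{ij} = z⁻¹ (β_j⋯β_k)(β_1⋯β_{i−1})` for `i < j`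
(0-based indices). -/
noncomputable def phiG (k : ℕ) (z : ℂ) (β : Fin k → ℂ) : Matrix (Fin k) (Fin k) ℂ :=
  (1 - (∏ i, β i) * z⁻¹)⁻¹ •
    Matrix.of fun (i j : Fin k) =>
      if (j : ℕ) ≤ (i : ℕ) then ∏ m ∈ Finset.Ico (j : ℕ) (i : ℕ), bval β m
      else z⁻¹ * (∏ m ∈ Finset.Ico (j : ℕ) k, bval β m) * ∏ m ∈ Finset.Ico 0 (i : ℕ), bval β m


theorem bval_val {k : ℕ} (β : Fin k → ℂ) (i : Fin k) : bval β (i : ℕ) = β i := by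
  simp [bval]

theorem prod_Ico_bval {k : ℕ} (β : Fin k → ℂ) :
    ∏ m ∈ Finset.Ico 0 k, bval β m = ∏ i, β i := by
  rw [← Finset.range_eq_Ico, Finset.prod_range]
  simp only [bval_val]

/-- Row `0` of `φ^b` acts by subtracting a `z⁻¹`-multiple of the last row. -/
theorem phiB_mul_zero (n : ℕ) (z : ℂ) (β : Fin (n + 1) → ℂ)
    (M : Matrix (Fin (n + 1)) (Fin (n + 1)) ℂ) (j : Fin (n + 1)) :
    (phiB (n + 1) z (fun i => -β i) (fun _ => 1) * M) 0 j =
      M 0 j - β (Fin.last n) * z⁻¹ * M (Fin.last n) j := by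
  have hlast (l : Fin (n + 1)) : (l : ℕ) = n ↔ l = Fin.last n := by simp [Fin.ext_iff]
  simp [Matrix.mul_apply, phiB, add_mul, Finset.sum_add_distrib, ite_mul, hlast]
  ring

/-- Row `i + 1` of `φ^b` acts by subtracting a multiple of row `i`. -/
theorem phiB_mul_succ (n : ℕ) (z : ℂ) (β : Fin (n + 1) → ℂ)
    (M : Matrix (Fin (n + 1)) (Fin (n + 1)) ℂ) (i : Fin n) (j : Fin (n + 1)) :
    (phiB (n + 1) z (fun i => -β i) (fun _ => 1) * M) i.succ j =
      M i.succ j - β i.castSucc * M i.castSucc j := by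
  have hcast (l : Fin (n + 1)) : (i : ℕ) = l ↔ i.castSucc = l := by simp [Fin.ext_iff]
  simp [Matrix.mul_apply, phiB, add_mul, Finset.sum_add_distrib, ite_mul, hcast]
  ring

theorem phiB_mul_phiG (k : ℕ) (z : ℂ) (β : Fin k → ℂ) (hz0 : z ≠ 0) (hzβ : z ≠ ∏ i, β i) :
    phiB k z (fun i => -β i) (fun _ => 1) * phiG k z β = 1 := by
  obtain _ | n := k
  · exact Subsingleton.elim _ _
  have hc : 1 - (∏ i, β i) * z⁻¹ ≠ 0 := by
    rw [← div_eq_mul_inv, sub_ne_zero]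
    intro h
    exact hzβ ((eq_div_iff hz0).mp h |>.symm ▸ (one_mul z).symm)
  rw [phiG, Matrix.mul_smul, inv_smul_eq_iff₀ hc]
  ext i j
  induction i using Fin.cases with
  | zero =>
    rw [phiB_mul_zero]
    have hsplit := Finset.prod_Ico_succ_top (Nat.le_of_lt_succ j.is_lt) (bval β)
    have hb : bval β n = β (Fin.last n) := bval_val β (Fin.last n)
    induction j using Fin.cases with
    | zero =>
      rw [hb, Fin.val_zero, prod_Ico_bval] at hsplit
      simp [hsplit]
      ring
    | succ j =>
      have hne : (0 : Fin (n + 1)) ≠ j.succ := (Fin.succ_ne_zero j).symm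
      rw [hb, Fin.val_succ] at hsplit
      have hj : j.succ ≤ Fin.last n := Fin.le_last _
      simp [hj, hsplit, hne]
      ring
  | succ i =>
    rw [phiB_mul_succ]
    have hb : bval β (i : ℕ) = β i.castSucc := bval_val β i.castSucc
    simp only [Matrix.of_apply, Fin.val_succ, Fin.val_castSucc, Matrix.smul_apply, smul_eq_mul,
      Matrix.one_apply, Fin.ext_iff]
    have hrow := Finset.prod_Ico_succ_top (Nat.zero_le (i : ℕ)) (bval β)
    rcases lt_trichotomy (j : ℕ) (i + 1) with h | h | h
    · have hji : (j : ℕ) ≤ i := Nat.le_of_lt_succ h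
      rw [if_pos h.le, if_pos hji, if_neg h.ne', Finset.prod_Ico_succ_top hji, hb]
      ring
    · have hprod := Finset.prod_Ico_consecutive (bval β) (Nat.zero_le ((i : ℕ) + 1))
        (Nat.succ_le_succ i.is_lt.le)
      rw [prod_Ico_bval, hrow, hb] at hprod
      rw [h, if_pos le_rfl, if_neg (by lia), if_pos rfl, ← hprod, Finset.Ico_self,
        Finset.prod_empty]
      ring
    · rw [if_neg (by lia), if_neg (by lia), if_neg h.ne, hrow, hb]
      ring

/-- `φ^g(z;β)·φ^b(z;−β,1) = I = φ^b(z;−β,1)·φ^g(z;β)` for `z ∉ {0, β}`; in particular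
`φ^g(z;β)` is invertible with inverse `φ^b(z;−β,1)`. -/
theorem statement1 (k : ℕ) (hk : 1 ≤ k) (β : Fin k → ℂ) (hβ : ∀ i, β i ≠ 0)
    (z : ℂ) (hz0 : z ≠ 0) (hzβ : z ≠ ∏ i, β i) :
    phiG k z β * phiB k z (fun i => -β i) (fun _ => 1) = 1 ∧
    phiB k z (fun i => -β i) (fun _ => 1) * phiG k z β = 1 ∧
    IsUnit (phiG k z β) ∧
    (phiG k z β)⁻¹ = phiB k z (fun i => -β i) (fun _ => 1) := by
  have hBG := phiB_mul_phiG k z β hz0 hzβ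
  have hGB := mul_eq_one_comm.mp hBG
  exact ⟨hGB, hBG, .of_mul_eq_one _ hGB, Matrix.inv_eq_right_inv hGB⟩
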